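/- Let E be a nontrivial finite-dimensional real inner product space, K ∈ ℝ, N < 0, f : E → ℝ continuously differentiable, and let ξ : [0,T) → E be continuous and continuously differentiable on (0,T). Then the following are equivalent: (a) for every z ∈ E and every t ∈ (0,T) (with ‖ξ(t) − z‖ < π√(N/K) when K < 0), the derivative D at t of s ↦ 𝔰_{K/N}(‖ξ(s) − z‖/2)² satisfies D + K·𝔰_{K/N}(‖ξ(t) − z‖/2)² ≤ (N/2)·(1 − f_N(z)/f_N(ξ(t))); (b) for every z ∈ E and all 0 ≤ t₀ ≤ t₁ < T (with sup_{t ∈ [t₀,t₁]} ‖ξ(t) − z‖ < π√(N/K) when K < 0), (N·(exp(K(t₁−t₀)) − 1)/(2K))·(1 − f_N(z)/f_N(ξ(t₁))) ≥ exp(K(t₁−t₀))·𝔰_{K/N}(‖ξ(t₁) − z‖/2)² − 𝔰_{K/N}(‖ξ(t₀) − z‖/2)², where (exp(K(t₁−t₀)) − 1)/K is read as t₁ − t₀ when K = 0. -/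

import Mathlib

open Real
open scoped RealInnerProductSpace

/-- The comparison function `𝔰_κ`. -/
noncomputable def sk (κ θ : ℝ) : ℝ :=
  if 0 < κ then Real.sin (Real.sqrt κ * θ) / Real.sqrt κ
  else if κ = 0 then θ
  else Real.sinh (Real.sqrt (-κ) * θ) / Real.sqrt (-κ)

/-- The comparison function `𝔠_κ`. -/
noncomputable def ck (κ θ : ℝ) : ℝ :=
  if 0 < κ then Real.cos (Real.sqrt κ * θ)
  else if κ = 0 then 1
  else Real.cosh (Real.sqrt (-κ) * θ)

/-- The distortion coefficient `σ_κ^{(t)}(θ)`. -/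
noncomputable def sg (κ t θ : ℝ) : ℝ := if θ = 0 then t else sk κ (t * θ) / sk κ θ

lemma hasDerivAt_sk (κ θ : ℝ) : HasDerivAt (sk κ) (ck κ θ) θ := by
  unfold sk ck
  split_ifs with h1 h2
  · have hs : Real.sqrt κ ≠ 0 := (Real.sqrt_pos.2 h1).ne'
    have := (((hasDerivAt_id θ).const_mul (Real.sqrt κ)).sin).div_const (Real.sqrt κ)
    refine this.congr_deriv ?_
    simp only [id]; field_simp
  · exact hasDerivAt_id θ
  · have h3 : 0 < -κ := by
      rcases lt_trichotomy κ 0 with h | h | h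
      · linarith
      · exact absurd h h2
      · exact absurd h h1
    have hs : Real.sqrt (-κ) ≠ 0 := (Real.sqrt_pos.2 h3).ne'
    have := (((hasDerivAt_id θ).const_mul (Real.sqrt (-κ))).sinh).div_const (Real.sqrt (-κ))
    refine this.congr_deriv ?_
    simp only [id]; field_simp

lemma differentiable_ck (κ : ℝ) : Differentiable ℝ (ck κ) := by
  unfold ck
  split_ifs with h1 h2 <;> fun_prop

lemma sk_zero (κ : ℝ) : sk κ 0 = 0 := by
  unfold sk; split_ifs <;> simp

lemma ck_zero (κ : ℝ) : ck κ 0 = 1 := by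
  unfold ck; split_ifs <;> simp

lemma hasDerivAt_sksq (κ r : ℝ) :
    HasDerivAt (fun r => sk κ (r / 2) ^ 2) (sk κ (r / 2) * ck κ (r / 2)) r := by
  have h := ((hasDerivAt_sk κ (r / 2)).comp r ((hasDerivAt_id r).div_const 2)).pow 2
  refine h.congr_deriv ?_
  simp only [Function.comp, id]
  ring

lemma hasDerivAt_S {E : Type*} [NormedAddCommGroup E] [InnerProductSpace ℝ E]
    (κ : ℝ) (ξ : ℝ → E) (v z : E) (t : ℝ) (h : HasDerivAt ξ v t) :
    HasDerivAt (fun s => sk κ (‖ξ s - z‖ / 2) ^ 2)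
      (sk κ (‖ξ t - z‖ / 2) * ck κ (‖ξ t - z‖ / 2) * (⟪ξ t - z, v⟫ / ‖ξ t - z‖)) t := by
  have h' : HasDerivAt (fun s => ξ s - z) v t := h.sub_const z
  by_cases hz : ξ t - z = 0
  · have h0 := hasDerivAt_sksq κ 0
    rw [hz]
    simp only [norm_zero, zero_div, sk_zero, zero_mul] at h0 ⊢
    rw [hasDerivAt_iff_isLittleO] at h0 ⊢
    simp only [zero_div, sk_zero, hz, norm_zero, smul_zero, sub_zero] at h0 ⊢
    have hc : Filter.Tendsto (fun s => ‖ξ s - z‖) (nhds t) (nhds 0) := by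
      have := h'.continuousAt.norm
      unfold ContinuousAt at this
      simpa [hz] using this
    have h1 := h0.comp_tendsto hc
    refine h1.trans_isBigO ?_
    have h2 := h'.isBigO_sub
    simp only [hz, sub_zero] at h2
    exact h2.norm_left
  · have hn : ‖ξ t - z‖ ≠ 0 := norm_ne_zero_iff.2 hz
    have h2 : HasDerivAt (fun s => ‖ξ s - z‖) (⟪ξ t - z, v⟫ / ‖ξ t - z‖) t := by
      have h3 := (h'.norm_sq).sqrt (by positivity)
      simp only [Real.sqrt_sq (norm_nonneg _)] at h3
      refine h3.congr_deriv ?_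
      field_simp
    exact (hasDerivAt_sksq κ ‖ξ t - z‖).comp t h2

lemma deriv_nonpos_right {G : ℝ → ℝ} {d t : ℝ} (h : HasDerivAt G d t) (h0 : G t = 0)
    (hG : ∀ᶠ s in nhdsWithin t (Set.Ioi t), G s ≤ 0) : d ≤ 0 := by
  have h1 := (hasDerivWithinAt_iff_tendsto_slope' (s := Set.Ioi t) (by simp)).1 h.hasDerivWithinAt
  refine le_of_tendsto h1 ?_
  filter_upwards [hG, self_mem_nhdsWithin] with s hs hs'
  rw [slope_def_field, h0, sub_zero]
  exact div_nonpos_of_nonpos_of_nonneg hs (sub_nonneg.2 (le_of_lt hs'))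

lemma deriv_nonpos_left {G : ℝ → ℝ} {d t : ℝ} (h : HasDerivAt G d t) (h0 : G t = 0)
    (hG : ∀ᶠ s in nhdsWithin t (Set.Iio t), 0 ≤ G s) : d ≤ 0 := by
  have h1 := (hasDerivWithinAt_iff_tendsto_slope' (s := Set.Iio t) (by simp)).1 h.hasDerivWithinAt
  refine le_of_tendsto h1 ?_
  filter_upwards [hG, self_mem_nhdsWithin] with s hs hs'
  rw [slope_def_field, h0, sub_zero]
  exact div_nonpos_of_nonneg_of_nonpos hs (sub_nonpos.2 (le_of_lt hs'))

lemma hasDerivAt_phi (K u : ℝ) :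
    HasDerivAt (fun u => if K = 0 then u else (Real.exp (K * u) - 1) / K) (Real.exp (K * u)) u := by
  split_ifs with h
  · simpa [h] using hasDerivAt_id' u
  · have := ((((hasDerivAt_id u).const_mul K).exp).sub_const 1).div_const K
    refine this.congr_deriv ?_
    simp only [id]; field_simp

/-- (a) forces `f` to decrease along the curve, infinitesimally. -/
lemma descent {E : Type*} [NormedAddCommGroup E] [InnerProductSpace ℝ E]
    (f : E → ℝ) (hf : ContDiff ℝ 1 f) (K N : ℝ) (hN : N < 0) (ξ : ℝ → E) (v : E) (t : ℝ)
    (hξ : HasDerivAt ξ v t)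
    (ha : ∀ z : E, (K < 0 → ‖ξ t - z‖ < π * Real.sqrt (N / K)) →
      ∃ D : ℝ, HasDerivAt (fun s => sk (K / N) (‖ξ s - z‖ / 2) ^ 2) D t ∧
        D + K * sk (K / N) (‖ξ t - z‖ / 2) ^ 2
          ≤ N / 2 * (1 - Real.exp (-f z / N) / Real.exp (-f (ξ t) / N))) :
    fderiv ℝ f (ξ t) v ≤ 0 := by
  by_cases hv : v = 0
  · simp [hv]
  have hnv : 0 < ‖v‖ := norm_pos_iff.2 hv
  set κ := K / N
  let H : ℝ → ℝ := fun ε => sk κ (ε * ‖v‖ / 2) * ck κ (ε * ‖v‖ / 2) * ‖v‖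
    + K * sk κ (ε * ‖v‖ / 2) ^ 2
    - N / 2 * (1 - Real.exp (-f (ξ t - ε • v) / N) / Real.exp (-f (ξ t) / N))
  have hlin : HasDerivAt (fun ε : ℝ => ε * ‖v‖ / 2) (‖v‖ / 2) 0 := by
    simpa using ((hasDerivAt_id (0:ℝ)).mul_const ‖v‖).div_const 2
  have hs : HasDerivAt (fun ε : ℝ => sk κ (ε * ‖v‖ / 2)) (‖v‖ / 2) 0 := by
    have := (hasDerivAt_sk κ ((0:ℝ) * ‖v‖ / 2)).comp (0:ℝ) hlin
    simpa [ck_zero, Function.comp_def] using this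
  have hc : HasDerivAt (fun ε : ℝ => ck κ (ε * ‖v‖ / 2)) (deriv (ck κ) 0 * (‖v‖ / 2)) 0 := by
    have := ((differentiable_ck κ ((0:ℝ) * ‖v‖ / 2)).hasDerivAt).comp (0:ℝ) hlin
    simpa [Function.comp_def] using this
  have hline : HasDerivAt (fun ε : ℝ => ξ t - ε • v) (-v) 0 := by
    simpa using ((hasDerivAt_id (0:ℝ)).smul_const v).const_sub (ξ t)
  have hff : HasDerivAt (fun ε : ℝ => f (ξ t - ε • v)) (-(fderiv ℝ f (ξ t) v)) 0 := by
    have hfd : HasFDerivAt f (fderiv ℝ f (ξ t)) (ξ t - (0:ℝ) • v) := by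
      simpa using (hf.differentiable (by norm_num) (ξ t)).hasFDerivAt
    have := hfd.comp_hasDerivAt (0:ℝ) hline
    simpa [Function.comp_def] using this
  have hexp := (((((hff.neg.div_const N).exp).div_const
    (Real.exp (-f (ξ t) / N))).const_sub 1).const_mul (N / 2))
  have hH : HasDerivAt H (‖v‖ ^ 2 / 2 + fderiv ℝ f (ξ t) v / 2) 0 := by
    have := (((hs.mul hc).mul_const ‖v‖).add ((hs.pow 2).const_mul K)).sub hexp
    refine this.congr_deriv ?_
    have hN' : N ≠ 0 := hN.ne
    have he : Real.exp (-f (ξ t) / N) ≠ 0 := (Real.exp_pos _).ne'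
    simp [sk_zero, ck_zero]
    field_simp
  have hH0 : H 0 = 0 := by simp [H, sk_zero]
  have hle := deriv_nonpos_right hH hH0 (by
    have hev : ∀ᶠ ε in nhdsWithin (0:ℝ) (Set.Ioi 0),
        (K < 0 → ε * ‖v‖ < π * Real.sqrt (N / K)) := by
      by_cases hK : K < 0
      · have hpos : 0 < π * Real.sqrt (N / K) :=
          mul_pos Real.pi_pos (Real.sqrt_pos.2 (div_pos_of_neg_of_neg hN hK))
        have hcont : ContinuousAt (fun ε : ℝ => ε * ‖v‖) 0 := by fun_prop
        have := hcont.eventually_lt (continuousAt_const (y := π * Real.sqrt (N / K)))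
          (by simpa using hpos)
        exact (this.filter_mono nhdsWithin_le_nhds).mono fun _ h _ => h
      · exact Filter.Eventually.of_forall fun _ h => absurd h hK
    filter_upwards [hev, self_mem_nhdsWithin] with ε h1 h2
    have h2' : 0 < ε := h2
    have hsub : ξ t - (ξ t - ε • v) = ε • v := by abel
    have hnorm : ‖ξ t - (ξ t - ε • v)‖ = ε * ‖v‖ := by
      rw [hsub, norm_smul, Real.norm_of_nonneg h2'.le]
    obtain ⟨D, hD, hDle⟩ := ha (ξ t - ε • v) (by rw [hnorm]; exact h1)
    have hDe := hD.unique (hasDerivAt_S κ ξ v (ξ t - ε • v) t hξ)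
    rw [hnorm, hsub, real_inner_smul_left, real_inner_self_eq_norm_sq] at hDe
    have : ε * ‖v‖ ^ 2 / (ε * ‖v‖) = ‖v‖ := by field_simp
    rw [this] at hDe
    rw [hnorm, hDe] at hDle
    simp only [H]
    linarith)
  have := sq_nonneg ‖v‖
  linarith

theorem stmt_13 {E : Type*} [NormedAddCommGroup E] [InnerProductSpace ℝ E]
    [FiniteDimensional ℝ E] [Nontrivial E]
    (f : E → ℝ) (hf : ContDiff ℝ 1 f) (K N : ℝ) (hN : N < 0)
    (T : ℝ) (ξ ξ' : ℝ → E)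
    (hξc : ContinuousOn ξ (Set.Ico 0 T))
    (hξd : ∀ t ∈ Set.Ioo (0:ℝ) T, HasDerivAt ξ (ξ' t) t)
    (hξ'c : ContinuousOn ξ' (Set.Ioo 0 T)) :
    (∀ z : E, ∀ t ∈ Set.Ioo (0:ℝ) T, (K < 0 → ‖ξ t - z‖ < π * Real.sqrt (N / K)) →
      ∃ D : ℝ, HasDerivAt (fun s => sk (K / N) (‖ξ s - z‖ / 2) ^ 2) D t ∧
        D + K * sk (K / N) (‖ξ t - z‖ / 2) ^ 2
          ≤ N / 2 * (1 - Real.exp (-f z / N) / Real.exp (-f (ξ t) / N)))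
    ↔
    (∀ z : E, ∀ t₀ t₁ : ℝ, 0 ≤ t₀ → t₀ ≤ t₁ → t₁ < T →
      (K < 0 → ∀ t ∈ Set.Icc t₀ t₁, ‖ξ t - z‖ < π * Real.sqrt (N / K)) →
      Real.exp (K * (t₁ - t₀)) * sk (K / N) (‖ξ t₁ - z‖ / 2) ^ 2
          - sk (K / N) (‖ξ t₀ - z‖ / 2) ^ 2
        ≤ N * (if K = 0 then t₁ - t₀ else (Real.exp (K * (t₁ - t₀)) - 1) / K) / 2 *
            (1 - Real.exp (-f z / N) / Real.exp (-f (ξ t₁) / N))) := by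
  constructor
  · intro ha z t₀ t₁ h0 h01 h1T hR
    have hfcont : Continuous f := hf.continuous
    have hanti : AntitoneOn (fun s => f (ξ s)) (Set.Ico 0 T) := by
      have hd : ∀ s ∈ Set.Ioo (0:ℝ) T,
          HasDerivAt (fun s => f (ξ s)) (fderiv ℝ f (ξ s) (ξ' s)) s := fun s hs =>
        ((hf.differentiable (by norm_num) (ξ s)).hasFDerivAt).comp_hasDerivAt s (hξd s hs)
      refine antitoneOn_of_deriv_nonpos (convex_Ico 0 T) (hfcont.comp_continuousOn hξc) ?_ ?_
      · rw [interior_Ico]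
        exact fun s hs => (hd s hs).differentiableAt.differentiableWithinAt
      · rw [interior_Ico]
        intro s hs
        rw [(hd s hs).deriv]
        exact descent f hf K N hN ξ (ξ' s) s (hξd s hs) fun z hz => ha z s hs hz
    set c := 1 - Real.exp (-f z / N) / Real.exp (-f (ξ t₁) / N) with hc
    let φ : ℝ → ℝ := fun u => if K = 0 then u else (Real.exp (K * u) - 1) / K
    have hφ : ∀ s, HasDerivAt (fun s => φ (s - t₀)) (Real.exp (K * (s - t₀))) s := fun s => by
      have := (hasDerivAt_phi K (s - t₀)).comp s ((hasDerivAt_id s).sub_const t₀)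
      simpa [Function.comp_def] using this
    have hE : ∀ s, HasDerivAt (fun s => Real.exp (K * (s - t₀)))
        (Real.exp (K * (s - t₀)) * K) s := fun s => by
      simpa using (((hasDerivAt_id s).sub_const t₀).const_mul K).exp
    let S : ℝ → ℝ := fun s => sk (K / N) (‖ξ s - z‖ / 2) ^ 2
    let Φ : ℝ → ℝ := fun s => Real.exp (K * (s - t₀)) * S s - N * φ (s - t₀) / 2 * c
    have hsub : Set.Icc t₀ t₁ ⊆ Set.Ico 0 T := fun s hs => ⟨h0.trans hs.1, hs.2.trans_lt h1T⟩
    have hskc : Continuous (sk (K / N)) :=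
      continuous_iff_continuousAt.2 fun x => (hasDerivAt_sk _ x).continuousAt
    have hφc : Continuous (fun s => φ (s - t₀)) :=
      continuous_iff_continuousAt.2 fun x => (hφ x).continuousAt
    have hΦc : ContinuousOn Φ (Set.Icc t₀ t₁) := by
      have hx : ContinuousOn ξ (Set.Icc t₀ t₁) := hξc.mono hsub
      have hS : ContinuousOn S (Set.Icc t₀ t₁) :=
        (hskc.comp_continuousOn (((hx.sub continuousOn_const).norm).div_const 2)).pow 2
      have hE' : Continuous (fun s => Real.exp (K * (s - t₀))) := by fun_prop
      exact (hE'.continuousOn.mul hS).sub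
        (((hφc.continuousOn.const_mul N).div_const 2).mul_const c)
    have hΦd : ∀ s ∈ Set.Ioo t₀ t₁, ∃ d, HasDerivAt Φ d s ∧ d ≤ 0 := by
      intro s hs
      have hsT : s ∈ Set.Ioo 0 T := ⟨h0.trans_lt hs.1, hs.2.trans h1T⟩
      obtain ⟨D, hD, hDle⟩ := ha z s hsT fun hK => hR hK s ⟨hs.1.le, hs.2.le⟩
      refine ⟨_, ((hE s).mul hD).sub ((((hφ s).const_mul N).div_const 2).mul_const c), ?_⟩
      have hmono : f (ξ t₁) ≤ f (ξ s) :=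
        hanti ⟨hsT.1.le, hsT.2⟩ ⟨h0.trans h01, h1T⟩ hs.2.le
      have hexp : Real.exp (-f (ξ t₁) / N) ≤ Real.exp (-f (ξ s) / N) :=
        Real.exp_le_exp.2 ((div_le_div_right_of_neg hN).2 (by linarith))
      have hq : Real.exp (-f z / N) / Real.exp (-f (ξ s) / N)
          ≤ Real.exp (-f z / N) / Real.exp (-f (ξ t₁) / N) := by gcongr
      have h3 : N / 2 * (1 - Real.exp (-f z / N) / Real.exp (-f (ξ s) / N)) ≤ N / 2 * c :=
        mul_le_mul_of_nonpos_left (by rw [hc]; linarith) (by linarith)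
      have h4 : D + K * sk (K / N) (‖ξ s - z‖ / 2) ^ 2 - N / 2 * c ≤ 0 := by linarith
      have h5 := mul_nonpos_of_nonneg_of_nonpos (Real.exp_pos (K * (s - t₀))).le h4
      linarith
    have hΦ : AntitoneOn Φ (Set.Icc t₀ t₁) := by
      refine antitoneOn_of_deriv_nonpos (convex_Icc _ _) hΦc ?_ ?_
      · rw [interior_Icc]
        intro s hs
        obtain ⟨d, hd, -⟩ := hΦd s hs
        exact hd.differentiableAt.differentiableWithinAt
      · rw [interior_Icc]
        intro s hs
        obtain ⟨d, hd, hd0⟩ := hΦd s hs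
        rwa [hd.deriv]
    have hfin := hΦ (Set.left_mem_Icc.2 h01) (Set.right_mem_Icc.2 h01) h01
    have h00 : Φ t₀ = S t₀ := by simp [Φ, φ]
    rw [h00] at hfin
    simp only [Φ, S, φ] at hfin
    linarith
  · intro hb z t ht hR
    have hD := hasDerivAt_S (K / N) ξ (ξ' t) z t (hξd t ht)
    refine ⟨_, hD, ?_⟩
    set D := sk (K / N) (‖ξ t - z‖ / 2) * ck (K / N) (‖ξ t - z‖ / 2) *
      (⟪ξ t - z, ξ' t⟫ / ‖ξ t - z‖)
    set c := 1 - Real.exp (-f z / N) / Real.exp (-f (ξ t) / N) with hc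
    let φ : ℝ → ℝ := fun u => if K = 0 then u else (Real.exp (K * u) - 1) / K
    have hφ : HasDerivAt (fun s => φ (t - s)) (-1) t := by
      have := (hasDerivAt_phi K (t - t)).comp t ((hasDerivAt_id t).const_sub t)
      simpa [Function.comp_def] using this
    have hE : HasDerivAt (fun s => Real.exp (K * (t - s))) (-K) t := by
      simpa using (((hasDerivAt_id t).const_sub t).const_mul K).exp
    let S : ℝ → ℝ := fun s => sk (K / N) (‖ξ s - z‖ / 2) ^ 2
    let G : ℝ → ℝ := fun s => N * φ (t - s) / 2 * c - (Real.exp (K * (t - s)) * S t - S s)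
    have hG := (((hφ.const_mul N).div_const 2).mul_const c).sub ((hE.mul_const (S t)).sub hD)
    have hev : ∀ᶠ s in nhds t, 0 < s ∧ (K < 0 → ‖ξ s - z‖ < π * Real.sqrt (N / K)) := by
      refine (lt_mem_nhds ht.1).and ?_
      by_cases hK : K < 0
      · have hcont : ContinuousAt (fun s => ‖ξ s - z‖) t :=
          ((hξd t ht).continuousAt.sub continuousAt_const).norm
        exact (hcont.eventually_lt continuousAt_const (hR hK)).mono fun _ h _ => h
      · exact Filter.Eventually.of_forall fun _ h => absurd h hK
    obtain ⟨δ, hδ, hball⟩ := Metric.eventually_nhds_iff.1 hev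
    have hle := deriv_nonpos_left (G := G) hG (by simp [G, φ]) (by
      filter_upwards [self_mem_nhdsWithin,
        nhdsWithin_le_nhds (lt_mem_nhds (show t - δ < t by linarith))] with s hs hs'
      have hs1 : s < t := hs
      have hs2 : t - δ < s := hs'
      have hin : ∀ u ∈ Set.Icc s t, dist u t < δ := fun u hu => by
        rw [Real.dist_eq, abs_lt]; constructor <;> linarith [hu.1, hu.2]
      have := hb z s t (hball (hin s ⟨le_rfl, hs1.le⟩)).1.le hs1.le ht.2
        fun hK u hu => (hball (hin u hu)).2 hK
      simp only [G, S, φ]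
      linarith)
    simp only [S] at hle
    linarith
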